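/- arXiv:1308.3268 — 3 statements merged into one kernel-verified Lean document; each statement's English description precedes it below -/
import Mathlib

section
/- Let A be a topological space, U an open neighborhood of 0 in ℝ^d, and f : A × U → ℝ^d a continuous map. Let a₀ ∈ A be such that the map f(a₀, ·) : U → ℝ^d is of class C¹, f(a₀, 0) = 0, and the derivative of f(a₀, ·) at 0 is a linear isomorphism of ℝ^d. Then there exist r > 0 with the closed ball of radius r around 0 contained in U, and a neighborhood W of a₀ in A, such that for every a ∈ W there exists m in the closed ball of radius r around 0 with f(a, m) = 0. -/
open Set Filter Topology MeasureTheory Polynomial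

/-- Evaluation of a polynomial with continuous coefficients. -/
noncomputable def evTX {E : Type*} [TopologicalSpace E] (t : ℝ) (x : E) : (C(E, ℝ))[X] →+* ℝ :=
  Polynomial.eval₂RingHom ((Pi.evalRingHom (fun _ : E => ℝ) x).comp ContinuousMap.coeFnRingHom) t

lemma evTX_C {E : Type*} [TopologicalSpace E] (t : ℝ) (x : E) (c : C(E, ℝ)) :
    evTX t x (C c) = c x := by
  simp [evTX]

lemma evTX_X {E : Type*} [TopologicalSpace E] (t : ℝ) (x : E) :
    evTX t x X = t := by
  simp [evTX]

lemma integral_evTX {d : ℕ} (Q : (C(EuclideanSpace ℝ (Fin d), ℝ))[X])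
    {K : Set (EuclideanSpace ℝ (Fin d))} (hK : IsCompact K) :
    ∃ p : ℝ[X], ∀ t, ∫ x in K, evTX t x Q = p.eval t := by
  induction Q using Polynomial.induction_on' with
  | add p q hp hq =>
    obtain ⟨p', hp⟩ := hp
    obtain ⟨q', hq⟩ := hq
    have hc : ∀ (Q : (C(EuclideanSpace ℝ (Fin d), ℝ))[X]) (t : ℝ),
        IntegrableOn (fun x => evTX t x Q) K := by
      intro Q t
      refine ContinuousOn.integrableOn_compact hK (Continuous.continuousOn ?_)
      simp only [evTX, coe_eval₂RingHom, eval₂_eq_sum_range]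
      refine continuous_finsetSum _ fun i _ => ?_
      exact ((Q.coeff i).continuous).mul continuous_const
    refine ⟨p' + q', fun t => ?_⟩
    simp only [map_add, eval_add, ← hp, ← hq]
    exact integral_add (hc p t) (hc q t)
  | monomial n c =>
    refine ⟨monomial n (∫ x in K, c x), fun t => ?_⟩
    simp only [evTX, coe_eval₂RingHom, eval₂_monomial, eval_monomial]
    exact integral_mul_const _ _

lemma integrand_eq {d : ℕ} {G : EuclideanSpace ℝ (Fin d) → EuclideanSpace ℝ (Fin d)}
    (hG : ContDiff ℝ 1 G) (M : ℝ) (N : ℕ) :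
    ∃ Q : (C(EuclideanSpace ℝ (Fin d), ℝ))[X], ∀ t x, evTX t x Q =
      (M - ‖x - t • G x‖ ^ 2) ^ N *
        (ContinuousLinearMap.id ℝ (EuclideanSpace ℝ (Fin d)) - t • fderiv ℝ G x).det := by
  have hD : Continuous (fderiv ℝ G) := hG.continuous_fderiv (by simp)
  have hGc : Continuous G := hG.continuous
  let c : Fin d → C(EuclideanSpace ℝ (Fin d), ℝ) := fun i => ⟨fun x => x i, by fun_prop⟩
  let g : Fin d → C(EuclideanSpace ℝ (Fin d), ℝ) := fun i => ⟨fun x => G x i, by fun_prop⟩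
  let D : Fin d → Fin d → C(EuclideanSpace ℝ (Fin d), ℝ) := fun i j =>
    ⟨fun x => (fderiv ℝ G x (EuclideanSpace.single j 1)) i, by fun_prop⟩
  let A : Matrix (Fin d) (Fin d) (C(EuclideanSpace ℝ (Fin d), ℝ))[X] :=
    1 - Matrix.of fun i j => X * C (D i j)
  refine ⟨(C (ContinuousMap.const _ M) - ∑ i, (C (c i) - X * C (g i)) ^ 2) ^ N * A.det, ?_⟩
  intro t x
  rw [map_mul, map_pow, map_sub, map_sum, RingHom.map_det]
  congr 1
  · congr 1
    rw [EuclideanSpace.norm_sq_eq]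
    simp [evTX_C, evTX_X, c, g]
    exact Finset.sum_congr rfl fun i _ => by ring
  · rw [ContinuousLinearMap.det, ← LinearMap.det_toMatrix (EuclideanSpace.basisFun (Fin d) ℝ).toBasis]
    congr 1
    ext i j
    simp only [A, RingHom.mapMatrix_apply, Matrix.map_apply, Matrix.sub_apply, Matrix.of_apply,
      map_sub, map_mul, evTX_C, evTX_X, LinearMap.toMatrix_apply]
    by_cases h : i = j <;> simp [Matrix.one_apply, h, D]

lemma near_zero {d : ℕ} {G : EuclideanSpace ℝ (Fin d) → EuclideanSpace ℝ (Fin d)}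
    (hG : ContDiff ℝ 1 G) {R : ℝ} (hs : ∀ x ∉ Metric.closedBall 0 R, G x = 0)
    (φ : EuclideanSpace ℝ (Fin d) → ℝ) :
    ∀ᶠ t in 𝓝 (0:ℝ), ∫ x in Metric.closedBall 0 R, φ (x - t • G x) *
        (ContinuousLinearMap.id ℝ (EuclideanSpace ℝ (Fin d)) - t • fderiv ℝ G x).det
      = ∫ x in Metric.closedBall 0 R, φ x := by
  have hD : Continuous (fderiv ℝ G) := hG.continuous_fderiv (by simp)
  obtain ⟨L, hL⟩ := ContDiff.lipschitzWith_of_hasCompactSupport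
    (HasCompactSupport.intro (isCompact_closedBall 0 R) hs) hG (by simp)
  have h1 : ∀ᶠ t in 𝓝 (0:ℝ), ∀ x ∈ Metric.closedBall (0 : EuclideanSpace ℝ (Fin d)) R,
      0 < (ContinuousLinearMap.id ℝ (EuclideanSpace ℝ (Fin d)) - t • fderiv ℝ G x).det := by
    refine (isCompact_closedBall _ R).eventually_forall_of_forall_eventually fun x _ => ?_
    have hc : Continuous fun z : ℝ × EuclideanSpace ℝ (Fin d) =>
        (ContinuousLinearMap.id ℝ (EuclideanSpace ℝ (Fin d)) - z.1 • fderiv ℝ G z.2).det :=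
      ContinuousLinearMap.continuous_det.comp (by fun_prop)
    refine hc.continuousAt.eventually_const_lt ?_
    simp [ContinuousLinearMap.det]
  have h2 : ∀ᶠ t in 𝓝 (0:ℝ), ‖t‖₊ * L < 1 := by
    have : Continuous fun t : ℝ => ‖t‖₊ * L := by fun_prop
    exact this.continuousAt.eventually_lt_const (by simp)
  filter_upwards [h1, h2] with t ht1 ht2
  have hcon : ∀ y, ContractingWith (‖t‖₊ * L) fun x => y + t • G x := by
    intro y
    refine ⟨ht2, LipschitzWith.of_dist_le_mul fun a b => ?_⟩
    rw [dist_add_left, dist_smul₀, NNReal.coe_mul, coe_nnnorm, mul_assoc]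
    gcongr
    exact hL.dist_le_mul a b
  have hinj : Function.Injective fun x => x - t • G x := by
    intro a b hab
    simp only at hab
    refine (hcon (a - t • G a)).fixedPoint_unique' (x := a) (y := b) ?_ ?_
    · simp [Function.IsFixedPt]
    · simp [Function.IsFixedPt, hab]
  have himg : (fun x => x - t • G x) '' Metric.closedBall 0 R = Metric.closedBall 0 R := by
    apply Subset.antisymm
    · rintro _ ⟨x, hx, rfl⟩
      by_contra hy
      have h0 := hs _ hy
      have : x - t • G x = x := hinj (by simp only [h0, smul_zero, sub_zero])
      simp only [this] at hy
      exact hy hx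
    · intro y hy
      have hfp := (hcon y).fixedPoint_isFixedPt
      set x := ContractingWith.fixedPoint _ (hcon y)
      have hxy : x - t • G x = y := by
        have : y + t • G x = x := hfp
        exact sub_eq_of_eq_add this.symm
      refine ⟨x, ?_, hxy⟩
      by_contra hx
      rw [hs x hx] at hxy
      simp at hxy
      exact hx (hxy ▸ hy)
  have := integral_image_eq_integral_abs_det_fderiv_smul volume
    (s := Metric.closedBall (0 : EuclideanSpace ℝ (Fin d)) R) (f := fun x => x - t • G x)
    (f' := fun x => ContinuousLinearMap.id ℝ _ - t • fderiv ℝ G x)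
    measurableSet_closedBall (fun x _ => ((hasFDerivAt_id x).sub
      (((hG.differentiable (by simp)) x).hasFDerivAt.const_smul t)).hasFDerivWithinAt)
    hinj.injOn φ
  rw [himg] at this
  rw [this]
  refine setIntegral_congr_fun measurableSet_closedBall fun x hx => ?_
  simp only [smul_eq_mul]
  rw [abs_of_pos (ht1 x hx), mul_comm]

lemma all_t {d : ℕ} {G : EuclideanSpace ℝ (Fin d) → EuclideanSpace ℝ (Fin d)}
    (hG : ContDiff ℝ 1 G) {R : ℝ} (hs : ∀ x ∉ Metric.closedBall 0 R, G x = 0) (M : ℝ) (N : ℕ) :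
    ∫ x in Metric.closedBall 0 R, (M - ‖x - G x‖ ^ 2) ^ N *
        (ContinuousLinearMap.id ℝ (EuclideanSpace ℝ (Fin d)) - fderiv ℝ G x).det
      = ∫ x in Metric.closedBall (0 : EuclideanSpace ℝ (Fin d)) R, (M - ‖x‖ ^ 2) ^ N := by
  obtain ⟨Q, hQ⟩ := integrand_eq hG M N
  obtain ⟨p, hp⟩ := integral_evTX Q (isCompact_closedBall (0 : EuclideanSpace ℝ (Fin d)) R)
  simp only [hQ] at hp
  have h := near_zero hG hs (fun x => (M - ‖x‖ ^ 2) ^ N)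
  simp only [hp] at h
  have : p = C (∫ x in Metric.closedBall (0 : EuclideanSpace ℝ (Fin d)) R, (M - ‖x‖ ^ 2) ^ N) := by
    apply Polynomial.eq_of_infinite_eval_eq
    refine infinite_of_mem_nhds (0:ℝ) ?_
    filter_upwards [h] with t ht
    simpa using ht
  have h1 := hp 1
  rw [this] at h1
  simpa using h1

lemma smooth_fixed {d : ℕ} {G : EuclideanSpace ℝ (Fin d) → EuclideanSpace ℝ (Fin d)}
    (hG : ContDiff ℝ 1 G) {R : ℝ} (hR : 0 < R) (hs : ∀ x ∉ Metric.closedBall 0 R, G x = 0) :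
    ∃ x, G x = x := by
  by_contra! hne
  set K := Metric.closedBall (0 : EuclideanSpace ℝ (Fin d)) R with hK
  have hKc : IsCompact K := isCompact_closedBall _ _
  have hKn : K.Nonempty := ⟨0, by simp [hK, hR.le]⟩
  have hGc := hG.continuous
  have hD : Continuous (fderiv ℝ G) := hG.continuous_fderiv (by simp)
  have hn : Continuous fun x => ‖x - G x‖ := by fun_prop
  obtain ⟨x0, hx0, hmin⟩ := hKc.exists_isMinOn hKn hn.continuousOn
  obtain ⟨x1, hx1, hmax⟩ := hKc.exists_isMaxOn hKn hn.continuousOn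
  set δ := ‖x0 - G x0‖
  have hδ : 0 < δ := norm_pos_iff.2 (sub_ne_zero.2 (hne x0).symm)
  set S := ‖x1 - G x1‖
  set M := S ^ 2 + R ^ 2 + 1 with hM
  have hdet : Continuous fun x =>
      (ContinuousLinearMap.id ℝ (EuclideanSpace ℝ (Fin d)) - fderiv ℝ G x).det :=
    ContinuousLinearMap.continuous_det.comp (by fun_prop)
  obtain ⟨B, hB⟩ := hKc.exists_bound_of_continuousOn hdet.continuousOn
  have hB0 : 0 ≤ B := (norm_nonneg _).trans (hB x0 hx0)
  have hδS : δ ≤ S := hmin hx1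
  -- inner radius
  set η := min (δ / 2) R with hη
  have hη0 : 0 < η := lt_min (by positivity) hR
  have hηδ : η < δ := (min_le_left _ _).trans_lt (by linarith)
  have hηR : η ≤ R := min_le_right _ _
  have hM1 : 0 < M - δ ^ 2 := by nlinarith
  have hM2 : M - δ ^ 2 < M - η ^ 2 := by nlinarith
  have hvK : volume K < ⊤ := hKc.measure_lt_top
  set V := volume.real K
  set v := volume.real (Metric.closedBall (0 : EuclideanSpace ℝ (Fin d)) η)
  have hv : 0 < v := by
    refine ENNReal.toReal_pos (Metric.measure_closedBall_pos _ _ hη0).ne'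
      (isCompact_closedBall _ _).measure_lt_top.ne
  have key : ∀ N : ℕ, (M - η ^ 2) ^ N * v ≤ (M - δ ^ 2) ^ N * B * V := by
    intro N
    have hall := all_t hG hs M N
    have hup : ‖∫ x in K, (M - ‖x - G x‖ ^ 2) ^ N *
        (ContinuousLinearMap.id ℝ (EuclideanSpace ℝ (Fin d)) - fderiv ℝ G x).det‖
        ≤ (M - δ ^ 2) ^ N * B * V := by
      refine norm_setIntegral_le_of_norm_le_const hvK fun x hx => ?_
      have ha : δ ≤ ‖x - G x‖ := hmin hx
      have hb : ‖x - G x‖ ≤ S := hmax hx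
      have hc : 0 ≤ M - ‖x - G x‖ ^ 2 := by nlinarith [norm_nonneg (x - G x)]
      rw [norm_mul, norm_pow, Real.norm_of_nonneg hc]
      gcongr
      exact hB x hx
    rw [hall] at hup
    refine le_trans ?_ ((Real.le_norm_self _).trans hup)
    have hcn : Continuous fun x : EuclideanSpace ℝ (Fin d) => (M - ‖x‖ ^ 2) ^ N := by fun_prop
    have hpos : ∀ x ∈ K, 0 ≤ M - ‖x‖ ^ 2 := by
      intro x hx
      have : ‖x‖ ≤ R := by simpa [hK] using hx
      nlinarith [norm_nonneg x]
    calc (M - η ^ 2) ^ N * v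
        = ∫ x in Metric.closedBall (0 : EuclideanSpace ℝ (Fin d)) η, (M - η ^ 2) ^ N := by
          simp [v, mul_comm]
      _ ≤ ∫ x in Metric.closedBall (0 : EuclideanSpace ℝ (Fin d)) η, (M - ‖x‖ ^ 2) ^ N := by
          refine setIntegral_mono_on ?_ ?_ measurableSet_closedBall fun x hx => ?_
          · exact continuousOn_const.integrableOn_compact (isCompact_closedBall _ _)
          · exact hcn.continuousOn.integrableOn_compact (isCompact_closedBall _ _)
          · have : ‖x‖ ≤ η := by simpa using hx
            have := hM1.trans hM2
            gcongr
      _ ≤ _ := by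
          refine setIntegral_mono_set (hcn.continuousOn.integrableOn_compact hKc) ?_ ?_
          · refine (ae_restrict_iff' measurableSet_closedBall).2 (Eventually.of_forall fun x hx => ?_)
            exact pow_nonneg (hpos x hx) N
          · exact (Metric.closedBall_subset_closedBall hηR).eventuallyLE
  set q := (M - δ ^ 2) / (M - η ^ 2) with hq
  have hMη := hM1.trans hM2
  have hq1 : q < 1 := (div_lt_one hMη).2 hM2
  have hq0 : 0 ≤ q := by positivity
  have hlim : Tendsto (fun N : ℕ => q ^ N * (B * V)) atTop (𝓝 0) := by
    simpa using (tendsto_pow_atTop_nhds_zero_of_lt_one hq0 hq1).mul_const (B * V)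
  have : v ≤ 0 := by
    refine ge_of_tendsto' hlim fun N => ?_
    rw [hq, div_pow, div_mul_eq_mul_div, le_div_iff₀ (by positivity)]
    linarith [key N]
  linarith

lemma brouwer_half {d : ℕ} {g : EuclideanSpace ℝ (Fin d) → EuclideanSpace ℝ (Fin d)} {r : ℝ}
    (hr : 0 < r) (hg : ContinuousOn g (Metric.closedBall 0 r))
    (hgr : ∀ x ∈ Metric.closedBall 0 r, ‖g x‖ ≤ r / 2) :
    ∃ x ∈ Metric.closedBall 0 r, g x = x := by
  by_contra! hne
  set K := Metric.closedBall (0 : EuclideanSpace ℝ (Fin d)) r with hK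
  have hKc : IsCompact K := isCompact_closedBall _ _
  have hKn : K.Nonempty := ⟨0, by simp [hK, hr.le]⟩
  obtain ⟨x0, hx0, hmin⟩ := hKc.exists_isMinOn hKn (f := fun x => ‖x - g x‖)
    (continuousOn_id.sub hg).norm
  set δ := ‖x0 - g x0‖
  have hδ : 0 < δ := norm_pos_iff.2 (sub_ne_zero.2 (hne x0 hx0).symm)
  obtain ⟨G0, hG0⟩ := ContinuousMap.exists_restrict_eq Metric.isClosed_closedBall
    (⟨K.domRestrict g, hg.domRestrict⟩ : C(K, EuclideanSpace ℝ (Fin d)))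
  have hG0' : ∀ x ∈ K, G0 x = g x := fun x hx => DFunLike.congr_fun hG0 ⟨x, hx⟩
  have hcl := ContinuousMap.dense_setOfPred_contDiff (E := EuclideanSpace ℝ (Fin d))
    (F := EuclideanSpace ℝ (Fin d)) G0
  rw [mem_closure_iff_nhds_basis
    (nhds_basis_uniformity Metric.uniformity_basis_dist.compactConvergenceUniformity)] at hcl
  have hε : 0 < min δ (r / 4) := by positivity
  obtain ⟨h, hh, hhd⟩ := hcl (K, min δ (r / 4)) ⟨hKc, hε⟩
  have hd : ∀ x ∈ K, ‖h x - g x‖ < min δ (r / 4) := by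
    intro x hx
    have := hhd x hx
    simp only [mem_ofPred_eq, dist_eq_norm] at this
    rwa [hG0' x hx] at this
  let χ : ContDiffBump (0 : EuclideanSpace ℝ (Fin d)) :=
    ⟨3 * r / 4, r, by positivity, by linarith⟩
  have hχ : ∀ x ∉ K, χ x = 0 := fun x hx => χ.zero_of_le_dist (by
    have : r < dist x 0 := by simpa [hK] using hx
    exact this.le)
  obtain ⟨x, hx⟩ := smooth_fixed (G := fun x => χ x • h x) (R := r)
    ((χ.contDiff.smul hh).of_le (by exact_mod_cast le_top)) hr (fun x hx => by simp [hχ x hx])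
  have hxK : x ∈ K := by
    by_contra hxK
    have : x = 0 := by rw [← hx]; simp [hχ x hxK]
    exact hxK (by simp [this, hK, hr.le])
  have hd := hd x hxK
  have h1 : ‖h x‖ ≤ 3 * r / 4 := by
    have := hgr x hxK
    have h2 : ‖h x‖ ≤ ‖h x - g x‖ + ‖g x‖ := by simpa using norm_add_le (h x - g x) (g x)
    have := min_le_right δ (r / 4)
    linarith
  have h2 : ‖x‖ ≤ 3 * r / 4 := by
    refine le_trans ?_ h1
    conv_lhs => rw [← hx]
    rw [norm_smul, Real.norm_of_nonneg χ.nonneg]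
    exact mul_le_of_le_one_left (norm_nonneg _) χ.le_one
  have h3 : χ x = 1 := χ.one_of_mem_closedBall (by simpa using h2)
  simp only [h3, one_smul] at hx
  rw [hx] at hd
  have : δ ≤ ‖x - g x‖ := hmin hxK
  have := min_le_left δ (r / 4)
  linarith


/-- **Persistence of zeros via topological degree (isomorphism case).**
Let `A` be a topological space, `U` an open neighborhood of `0` in `ℝ^d`, and
`f : A × U → ℝ^d` continuous.  If `f(a₀, ·)` is `C¹`, `f(a₀, 0) = 0`, and the derivative
of `f(a₀, ·)` at `0` is a linear isomorphism of `ℝ^d`, then there are `r > 0` with the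
closed ball of radius `r` contained in `U`, and a neighborhood `W` of `a₀`, such that for
every `a ∈ W` the map `f(a, ·)` has a zero in the closed ball of radius `r`. -/
theorem zeros_persist_of_isomorphic_derivative
    {A : Type*} [TopologicalSpace A] {d : ℕ} (hd : 1 ≤ d)
    (U : Set (EuclideanSpace ℝ (Fin d))) (hU : IsOpen U)
    (hU0 : (0 : EuclideanSpace ℝ (Fin d)) ∈ U)
    (f : A → EuclideanSpace ℝ (Fin d) → EuclideanSpace ℝ (Fin d))
    (hf : ContinuousOn (fun p : A × EuclideanSpace ℝ (Fin d) => f p.1 p.2)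
      (Set.univ ×ˢ U))
    (a₀ : A) (hC1 : ContDiffOn ℝ 1 (f a₀) U) (hf0 : f a₀ 0 = 0)
    (hderiv : Function.Bijective (fderiv ℝ (f a₀) 0)) :
    ∃ r : ℝ, 0 < r ∧ Metric.closedBall (0 : EuclideanSpace ℝ (Fin d)) r ⊆ U ∧
      ∃ W ∈ nhds a₀, ∀ a ∈ W,
        ∃ m ∈ Metric.closedBall (0 : EuclideanSpace ℝ (Fin d)) r, f a m = 0 := by
  have hdiff : HasFDerivAt (f a₀) (fderiv ℝ (f a₀) 0) 0 :=
    ((hC1.contDiffAt (hU.mem_nhds hU0)).differentiableAt (by simp)).hasFDerivAt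
  let L : EuclideanSpace ℝ (Fin d) ≃L[ℝ] EuclideanSpace ℝ (Fin d) :=
    (LinearEquiv.ofBijective (fderiv ℝ (f a₀) 0).toLinearMap hderiv).toContinuousLinearEquiv
  have hL : ∀ x, L.symm (fderiv ℝ (f a₀) 0 x) = x := fun x => L.symm_apply_apply x
  -- the auxiliary map whose fixed points are zeros
  have hg0 : HasFDerivAt (fun m => m - L.symm (f a₀ m))
      (0 : EuclideanSpace ℝ (Fin d) →L[ℝ] EuclideanSpace ℝ (Fin d)) 0 := by
    have h := (hasFDerivAt_id (𝕜 := ℝ) (0 : EuclideanSpace ℝ (Fin d))).sub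
      (L.symm.toContinuousLinearMap.hasFDerivAt.comp 0 hdiff)
    refine h.congr_fderiv ?_
    ext1 x
    simp [hL]
  have hlit := hg0.isLittleO.def (c := 1 / 4) (by norm_num)
  obtain ⟨ρ, hρ, hρU⟩ := Metric.eventually_nhds_iff_ball.1 (hlit.and (hU.mem_nhds hU0))
  set r := ρ / 2 with hrdef
  have hr : 0 < r := by positivity
  have hsub : ∀ x ∈ Metric.closedBall (0 : EuclideanSpace ℝ (Fin d)) r,
      x ∈ Metric.ball (0 : EuclideanSpace ℝ (Fin d)) ρ := fun x hx =>
    Metric.closedBall_subset_ball (by linarith) hx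
  have hKU : Metric.closedBall (0 : EuclideanSpace ℝ (Fin d)) r ⊆ U :=
    fun x hx => (hρU x (hsub x hx)).2
  have hcont : ContinuousOn (fun p : A × EuclideanSpace ℝ (Fin d) => ‖p.2 - L.symm (f p.1 p.2)‖)
      (Set.univ ×ˢ U) :=
    (continuousOn_snd.sub (L.symm.continuous.comp_continuousOn hf)).norm
  have hev : ∀ᶠ a in nhds a₀, ∀ m ∈ Metric.closedBall (0 : EuclideanSpace ℝ (Fin d)) r,
      ‖m - L.symm (f a m)‖ < r / 2 := by
    refine (isCompact_closedBall _ _).eventually_forall_of_forall_eventually fun m hm => ?_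
    have hca := hcont.continuousAt (x := (a₀, m))
      (prod_mem_nhds Filter.univ_mem (hU.mem_nhds (hKU hm)))
    refine hca.eventually_lt_const ?_
    have h1 := (hρU m (hsub m hm)).1
    simp only [hf0, map_zero, sub_zero, ContinuousLinearMap.zero_apply] at h1
    have h2 : ‖m‖ ≤ r := by simpa using hm
    simp only
    linarith
  refine ⟨r, hr, hKU, _, hev, fun a ha => ?_⟩
  have hga : ContinuousOn (fun m => m - L.symm (f a m))
      (Metric.closedBall (0 : EuclideanSpace ℝ (Fin d)) r) := by
    refine continuousOn_id.sub (L.symm.continuous.comp_continuousOn ?_)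
    exact hf.comp (f := fun m => (a, m)) (by fun_prop) (fun m hm => ⟨trivial, hKU hm⟩)
  obtain ⟨m, hm, hfix⟩ := brouwer_half hr hga fun x hx => (ha x hx).le
  refine ⟨m, hm, ?_⟩
  simpa using hfix
end

section
/- Let A be a topological space, s ≥ d ≥ 1 integers, U an open neighborhood of 0 in ℝ^s, and f : A × U → ℝ^d a continuous map. Let a₀ ∈ A be such that the map f(a₀, ·) : U → ℝ^d is of class C¹, f(a₀, 0) = 0, and the derivative of f(a₀, ·) at 0 is a surjective linear map ℝ^s → ℝ^d. Then there exist r > 0 with the closed ball of radius r around 0 contained in U, and a neighborhood W of a₀ in A, such that for every a ∈ W there exists m in the closed ball of radius r around 0 with f(a, m) = 0. -/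
open MeasureTheory Metric Set

lemma aux_poly {d : ℕ} (M : EuclideanSpace ℝ (Fin d) →L[ℝ] EuclideanSpace ℝ (Fin d)) :
    ∃ p : Polynomial ℝ, p.degree < ((d + 1 : ℕ) : WithBot ℕ) ∧
      ∀ t : ℝ, p.eval t = (ContinuousLinearMap.id ℝ _ + t • M).det := by
  let b := (EuclideanSpace.basisFun (Fin d) ℝ).toBasis
  let A := LinearMap.toMatrix b b (M : EuclideanSpace ℝ (Fin d) →ₗ[ℝ] EuclideanSpace ℝ (Fin d))
  refine ⟨((Polynomial.X : Polynomial ℝ) • A.map Polynomial.C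
    + (1 : Matrix (Fin d) (Fin d) ℝ).map Polynomial.C).det, ?_, ?_⟩
  · refine Polynomial.degree_lt_iff_coeff_zero _ _ |>.2 ?_
    intro m hm
    apply Polynomial.coeff_eq_zero_of_natDegree_lt
    have := Polynomial.natDegree_det_X_add_C_le A 1
    simp only [Fintype.card_fin] at this
    omega
  · intro t
    rw [← Polynomial.coe_evalRingHom, RingHom.map_det]
    rw [ContinuousLinearMap.det, ← LinearMap.det_toMatrix b]
    congr 1
    ext i j
    simp [A, Matrix.one_apply, LinearMap.toMatrix_apply, b]
    by_cases h : i = j <;> simp [h] <;> ring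

lemma aux_bij {d : ℕ} (hd : 1 ≤ d)
    (k : EuclideanSpace ℝ (Fin d) → EuclideanSpace ℝ (Fin d))
    (hk0 : ∀ x, ‖x‖ = 1 → k x = 0) (hk1 : ∀ x, ‖x‖ ≤ 1 → ‖x + k x‖ ≤ 1)
    (L : ℝ) (hL0 : 0 ≤ L)
    (hL : ∀ x y, ‖x‖ ≤ 1 → ‖y‖ ≤ 1 → ‖k x - k y‖ ≤ L * ‖x - y‖)
    (t : ℝ) (ht0 : 0 ≤ t) (ht1 : t ≤ 1) (htL : t * L < 1) :
    InjOn (fun x => x + t • k x) (closedBall 0 1) ∧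
    (fun x => x + t • k x) '' (closedBall 0 1) = closedBall 0 1 := by
  classical
  constructor
  · intro x hx y hy hxy
    simp only [mem_closedBall_zero_iff] at hx hy hxy
    have h1 : x - y = - (t • (k x - k y)) := by
      rw [smul_sub, neg_sub, sub_eq_sub_iff_add_eq_add, hxy]; abel
    have h2 : ‖x - y‖ ≤ t * L * ‖x - y‖ := by
      calc ‖x - y‖ = t * ‖k x - k y‖ := by
            rw [h1, norm_neg, norm_smul, Real.norm_of_nonneg ht0]
        _ ≤ t * (L * ‖x - y‖) := by gcongr; exact hL x y hx hy
        _ = _ := by ring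
    have h3 : ‖x - y‖ = 0 := by nlinarith [norm_nonneg (x - y)]
    exact sub_eq_zero.1 (norm_eq_zero.1 h3)
  · apply Subset.antisymm
    · rintro _ ⟨x, hx, rfl⟩
      simp only [mem_closedBall_zero_iff] at hx ⊢
      have : x + t • k x = (1 - t) • x + t • (x + k x) := by module
      rw [this]
      calc _ ≤ ‖(1 - t) • x‖ + ‖t • (x + k x)‖ := norm_add_le _ _
        _ = (1 - t) * ‖x‖ + t * ‖x + k x‖ := by
            rw [norm_smul, norm_smul, Real.norm_of_nonneg ht0, Real.norm_of_nonneg (by linarith)]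
        _ ≤ (1 - t) * 1 + t * 1 := by
            have := hk1 x hx
            have : 0 ≤ 1 - t := by linarith
            gcongr
        _ = 1 := by ring
    · intro y hy
      simp only [mem_closedBall_zero_iff] at hy
      let k' : (EuclideanSpace ℝ (Fin d)) → (EuclideanSpace ℝ (Fin d)) := fun x => if ‖x‖ ≤ 1 then k x else 0
      have hb : ∀ x, ‖x‖ ≤ 1 → ‖k x‖ ≤ L * (1 - ‖x‖) := by
        intro x hx
        obtain ⟨z, hz, hxz⟩ : ∃ z : (EuclideanSpace ℝ (Fin d)), ‖z‖ = 1 ∧ ‖x - z‖ = 1 - ‖x‖ := by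
          by_cases h0 : x = 0
          · refine ⟨EuclideanSpace.single ⟨0, hd⟩ 1, by simp, by simp [h0]⟩
          · have hn : 0 < ‖x‖ := norm_pos_iff.2 h0
            refine ⟨‖x‖⁻¹ • x, by rw [norm_smul, norm_inv, norm_norm]; field_simp, ?_⟩
            have : x - ‖x‖⁻¹ • x = -((‖x‖⁻¹ - 1) • x) := by module
            have h1 : 0 ≤ ‖x‖⁻¹ - 1 := by
              have := (one_le_inv₀ hn).2 hx
              linarith
            rw [this, norm_neg, norm_smul, Real.norm_of_nonneg h1]
            field_simp
        have := hL x z hx hz.le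
        rwa [hk0 z hz, sub_zero, hxz] at this
      have hk' : ∀ x y, ‖k' x - k' y‖ ≤ L * ‖x - y‖ := by
        intro x y
        by_cases hx : ‖x‖ ≤ 1 <;> by_cases hy : ‖y‖ ≤ 1
        · simpa [k', hx, hy] using hL x y hx hy
        · simp only [k', hx, hy, if_true, if_false, sub_zero]
          refine (hb x hx).trans ?_
          gcongr
          have := norm_sub_norm_le y x
          rw [norm_sub_rev] at this
          linarith
        · simp only [k', hx, hy, if_true, if_false, zero_sub, norm_neg]
          refine (hb y hy).trans ?_
          gcongr
          have := norm_sub_norm_le x y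
          linarith
        · simp only [k', hx, hy, if_false, sub_zero, norm_zero]
          positivity
      have hc : ContractingWith (Real.toNNReal (t * L)) (fun x => y - t • k' x) := by
        refine ⟨by rw [Real.toNNReal_lt_one]; exact htL, LipschitzWith.of_dist_le_mul ?_⟩
        intro u v
        rw [dist_eq_norm, dist_eq_norm]
        have : y - t • k' u - (y - t • k' v) = -(t • (k' u - k' v)) := by module
        rw [this, norm_neg, norm_smul, Real.norm_of_nonneg ht0]
        calc _ ≤ t * (L * ‖u - v‖) := by gcongr; exact hk' u v
          _ = _ := by rw [Real.coe_toNNReal _ (by positivity)]; ring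
      let x := hc.fixedPoint
      have hx : y - t • k' x = x := hc.fixedPoint_isFixedPt
      have hx1 : ‖x‖ ≤ 1 := by
        by_contra h
        have : k' x = 0 := by simp [k', h]
        rw [this, smul_zero, sub_zero] at hx
        rw [← hx] at h
        exact h hy
      refine ⟨x, by simpa using hx1, ?_⟩
      have : k' x = k x := by simp [k', hx1]
      rw [this] at hx
      show x + t • k x = y
      nth_rewrite 1 [← hx]
      simp

lemma aux_vol {d : ℕ} (hd : 1 ≤ d)
    (k : EuclideanSpace ℝ (Fin d) → EuclideanSpace ℝ (Fin d)) (hk : ContDiff ℝ 1 k)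
    (hk0 : ∀ x, ‖x‖ = 1 → k x = 0) (hk1 : ∀ x, ‖x‖ ≤ 1 → ‖x + k x‖ ≤ 1) :
    ∃ t₀ : ℝ, 0 < t₀ ∧ ∀ t : ℝ, 0 ≤ t → t ≤ t₀ →
      ∫ x in closedBall (0 : EuclideanSpace ℝ (Fin d)) 1,
        (ContinuousLinearMap.id ℝ _ + t • fderiv ℝ k x).det
        = volume.real (closedBall (0 : EuclideanSpace ℝ (Fin d)) 1) := by
  have hdc : Continuous (fderiv ℝ k) := hk.continuous_fderiv (by norm_num)
  obtain ⟨C, hC⟩ := (isCompact_closedBall (0 : (EuclideanSpace ℝ (Fin d))) 1).exists_bound_of_continuousOn hdc.continuousOn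
  let L := max C 1
  have hL1 : 1 ≤ L := le_max_right _ _
  have hLb : ∀ x : (EuclideanSpace ℝ (Fin d)), ‖x‖ ≤ 1 → ‖fderiv ℝ k x‖ ≤ L := fun x hx =>
    (hC x (by simpa using hx)).trans (le_max_left _ _)
  have hLip : ∀ x y : (EuclideanSpace ℝ (Fin d)), ‖x‖ ≤ 1 → ‖y‖ ≤ 1 → ‖k x - k y‖ ≤ L * ‖x - y‖ := by
    intro x y hx hy
    refine (convex_closedBall (0 : (EuclideanSpace ℝ (Fin d))) 1).norm_image_sub_le_of_norm_fderiv_le (𝕜 := ℝ)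
      (fun z _ => (hk.differentiable (by norm_num)).differentiableAt)
      (fun z hz => hLb z (by simpa using hz)) (by simpa using hy) (by simpa using hx)
  have hdet : ∀ᶠ B : (EuclideanSpace ℝ (Fin d)) →L[ℝ] (EuclideanSpace ℝ (Fin d)) in nhds 0, 0 < (ContinuousLinearMap.id ℝ (EuclideanSpace ℝ (Fin d)) + B).det := by
    have hcont : Continuous fun B : (EuclideanSpace ℝ (Fin d)) →L[ℝ] (EuclideanSpace ℝ (Fin d)) => (ContinuousLinearMap.id ℝ (EuclideanSpace ℝ (Fin d)) + B).det :=
      ContinuousLinearMap.continuous_det.comp (by fun_prop)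
    refine hcont.continuousAt.eventually_const_lt ?_
    simp [ContinuousLinearMap.det]
  obtain ⟨ε, hε, hεd⟩ := Metric.eventually_nhds_iff.1 hdet
  refine ⟨min (1 / (2 * L)) (ε / (2 * L)), by positivity, ?_⟩
  intro t ht0 ht
  have hta : t * L ≤ 1 / 2 := by
    have := ht.trans (min_le_left _ _)
    rw [le_div_iff₀ (by positivity)] at this
    linarith
  have htb : t * L ≤ ε / 2 := by
    have := ht.trans (min_le_right _ _)
    rw [le_div_iff₀ (by positivity)] at this
    linarith
  obtain ⟨hinj, himg⟩ := aux_bij hd k hk0 hk1 L (by positivity) hLip t ht0 (by nlinarith)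
    (by linarith)
  have hder : ∀ x ∈ closedBall (0 : (EuclideanSpace ℝ (Fin d))) 1, HasFDerivWithinAt (fun x => x + t • k x)
      (ContinuousLinearMap.id ℝ _ + t • fderiv ℝ k x) (closedBall 0 1) x := by
    intro x _
    exact ((hasFDerivAt_id x).add
      (((hk.differentiable (by norm_num)) x).hasFDerivAt.const_smul t)).hasFDerivWithinAt
  have key := integral_image_eq_integral_abs_det_fderiv_smul volume
    (measurableSet_closedBall (x := (0 : (EuclideanSpace ℝ (Fin d)))) (ε := 1)) hder hinj (fun _ => (1 : ℝ))
  rw [himg] at key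
  simp only [smul_eq_mul, mul_one, integral_const, MeasurableSet.univ, measureReal_restrict_apply,
    univ_inter] at key
  rw [key]
  refine setIntegral_congr_fun measurableSet_closedBall ?_
  intro x hx
  have hx : ‖x‖ ≤ 1 := by simpa using hx
  refine (abs_of_pos (hεd ?_)).symm
  rw [dist_zero_right, norm_smul, Real.norm_of_nonneg ht0]
  calc _ ≤ t * L := by gcongr; exact hLb x hx
    _ < ε := by linarith

lemma aux_noretr {d : ℕ} (hd : 1 ≤ d)
    (g : EuclideanSpace ℝ (Fin d) → EuclideanSpace ℝ (Fin d)) (hg : ContDiff ℝ 1 g)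
    (hg1 : ∀ x, ‖g x‖ = 1) (hgs : ∀ x, ‖x‖ = 1 → g x = x) : False := by
  let k : (EuclideanSpace ℝ (Fin d)) → (EuclideanSpace ℝ (Fin d)) := fun x => g x - x
  have hk : ContDiff ℝ 1 k := hg.sub contDiff_id
  obtain ⟨t₀, ht₀, hvol⟩ := aux_vol hd k hk (fun x hx => by simp [k, hgs x hx])
    (fun x hx => by simp [k, hg1])
  have hdc : Continuous (fderiv ℝ k) := hk.continuous_fderiv (by norm_num)
  have hcont : ∀ t : ℝ, Continuous fun x => (ContinuousLinearMap.id ℝ (EuclideanSpace ℝ (Fin d)) + t • fderiv ℝ k x).det :=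
    fun t => ContinuousLinearMap.continuous_det.comp (by fun_prop)
  have hint : ∀ t : ℝ, IntegrableOn
      (fun x => (ContinuousLinearMap.id ℝ (EuclideanSpace ℝ (Fin d)) + t • fderiv ℝ k x).det) (closedBall 0 1) volume :=
    fun t => (hcont t).continuousOn.integrableOn_compact (isCompact_closedBall _ _)
  let v : ℕ → ℝ := fun i => t₀ / (i + 1)
  let s := Finset.range (d + 1)
  have hv : Set.InjOn v s := by
    intro i _ j _ hij
    simp only [v] at hij
    have hi : (0 : ℝ) < i + 1 := by positivity
    have hj : (0 : ℝ) < j + 1 := by positivity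
    field_simp at hij
    have : (i : ℝ) = j := by linarith
    exact_mod_cast this
  have hlag : ∀ x, (ContinuousLinearMap.id ℝ (EuclideanSpace ℝ (Fin d)) + (1 : ℝ) • fderiv ℝ k x).det =
      ∑ i ∈ s, (ContinuousLinearMap.id ℝ (EuclideanSpace ℝ (Fin d)) + v i • fderiv ℝ k x).det *
        (Lagrange.basis s v i).eval 1 := by
    intro x
    obtain ⟨p, hp, hpe⟩ := aux_poly (fderiv ℝ k x)
    have := Lagrange.eq_interpolate (s := s) hv (f := p) (by simpa [s] using hp)
    rw [← hpe]
    conv_lhs => rw [this]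
    rw [Lagrange.interpolate_apply, Polynomial.eval_finsetSum]
    simp only [Polynomial.eval_mul, Polynomial.eval_C]
    refine Finset.sum_congr rfl fun i _ => ?_
    rw [← hpe]
  have hsum : ∫ x in closedBall (0 : (EuclideanSpace ℝ (Fin d))) 1,
      (ContinuousLinearMap.id ℝ (EuclideanSpace ℝ (Fin d)) + (1 : ℝ) • fderiv ℝ k x).det
      = volume.real (closedBall (0 : (EuclideanSpace ℝ (Fin d))) 1) := by
    simp_rw [hlag]
    rw [integral_finsetSum _ (fun i _ => (hint (v i)).mul_const _)]
    simp_rw [integral_mul_const]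
    have h1 : ∀ i ∈ s, (∫ x in closedBall (0 : (EuclideanSpace ℝ (Fin d))) 1,
        (ContinuousLinearMap.id ℝ (EuclideanSpace ℝ (Fin d)) + v i • fderiv ℝ k x).det) * (Lagrange.basis s v i).eval 1
        = volume.real (closedBall (0 : (EuclideanSpace ℝ (Fin d))) 1) * (Lagrange.basis s v i).eval 1 := by
      intro i _
      rw [hvol (v i) (by positivity)]
      apply div_le_self ht₀.le
      have : (0 : ℝ) ≤ i := by positivity
      linarith
    rw [Finset.sum_congr rfl h1, ← Finset.mul_sum, ← Polynomial.eval_finsetSum,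
      Lagrange.sum_basis hv (by simp [s])]
    simp
  have hzero : ∀ x, (ContinuousLinearMap.id ℝ (EuclideanSpace ℝ (Fin d)) + (1 : ℝ) • fderiv ℝ k x).det = 0 := by
    intro x
    have hgd : DifferentiableAt ℝ g x := hg.differentiable (by norm_num) x
    have he : ContinuousLinearMap.id ℝ (EuclideanSpace ℝ (Fin d)) + (1 : ℝ) • fderiv ℝ k x = fderiv ℝ g x := by
      have : fderiv ℝ k x = fderiv ℝ g x - ContinuousLinearMap.id ℝ (EuclideanSpace ℝ (Fin d)) :=
        (hgd.hasFDerivAt.sub (hasFDerivAt_id x)).fderiv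
      rw [this]; simp
    rw [he]
    by_contra hne
    have hu : Function.Surjective (fderiv ℝ g x) := by
      have := ((fderiv ℝ g x).toContinuousLinearEquivOfDetNeZero hne).surjective
      exact this
    obtain ⟨w, hw⟩ := hu (g x)
    have h2 := (hgd.hasFDerivAt.inner ℝ hgd.hasFDerivAt)
    have h3 : (fun y => inner ℝ (g y) (g y)) = fun _ => (1 : ℝ) := by
      ext y; rw [real_inner_self_eq_norm_sq, hg1]; norm_num
    rw [h3] at h2
    have h4 := congrArg (fun T => T w) (h2.unique (hasFDerivAt_const (1 : ℝ) x))
    simp [fderivInnerCLM_apply, hw, hg1] at h4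
  simp_rw [hzero] at hsum
  simp only [integral_zero] at hsum
  have : 0 < volume.real (closedBall (0 : (EuclideanSpace ℝ (Fin d))) 1) :=
    ENNReal.toReal_pos (measure_closedBall_pos _ _ one_pos).ne' measure_closedBall_lt_top.ne
  linarith

lemma aux_zero1 {d : ℕ} (hd : 1 ≤ d)
    (h : EuclideanSpace ℝ (Fin d) → EuclideanSpace ℝ (Fin d))
    (hc : ContinuousOn h (closedBall 0 1))
    (hh : ∀ x, ‖x‖ ≤ 1 → ‖h x - x‖ ≤ 1 / 2) : ∃ x, ‖x‖ ≤ 1 ∧ h x = 0 := by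
  by_contra! hne
  obtain ⟨H, hH⟩ := ContinuousMap.exists_restrict_eq (isClosed_closedBall (x := (0 : (EuclideanSpace ℝ (Fin d)))) (ε := 1))
    ⟨_, hc.domRestrict⟩
  have hHx : ∀ x : (EuclideanSpace ℝ (Fin d)), ‖x‖ ≤ 1 → H x = h x := fun x hx =>
    congrArg (fun F => F (⟨x, by simpa using hx⟩ : closedBall (0 : (EuclideanSpace ℝ (Fin d))) 1)) hH
  obtain ⟨x0, hx0, hmin⟩ := (isCompact_closedBall (0 : (EuclideanSpace ℝ (Fin d))) 1).exists_isMinOn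
    ⟨0, by simp⟩ hc.norm
  have hδ : 0 < ‖h x0‖ := norm_pos_iff.2 (hne x0 (by simpa using hx0))
  set δ := ‖h x0‖
  have hδle : ∀ x : (EuclideanSpace ℝ (Fin d)), ‖x‖ ≤ 1 → δ ≤ ‖h x‖ := fun x hx => hmin (by simpa using hx)
  have hdense := ContinuousMap.dense_setOfPred_contDiff (E := EuclideanSpace ℝ (Fin d)) (F := EuclideanSpace ℝ (Fin d)) H
  rw [mem_closure_iff_nhds_basis
    (nhds_basis_uniformity Metric.uniformity_basis_dist.compactConvergenceUniformity)] at hdense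
  obtain ⟨G, hG, hGd⟩ := hdense (closedBall (0 : (EuclideanSpace ℝ (Fin d))) 1, min δ (1 / 4))
    ⟨isCompact_closedBall _ _, by positivity⟩
  have hG : ContDiff ℝ 1 G := ContDiff.of_le (Set.mem_ofPred_eq ▸ hG) (by exact_mod_cast le_top)
  have hGh : ∀ x : (EuclideanSpace ℝ (Fin d)), ‖x‖ ≤ 1 → ‖G x - h x‖ < min δ (1 / 4) := by
    intro x hx
    have := hGd x (by simpa using hx)
    rw [← hHx x hx]
    simpa [dist_eq_norm] using this
  let φ : ContDiffBump (0 : (EuclideanSpace ℝ (Fin d))) := ⟨4 / 5, 1, by norm_num, by norm_num⟩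
  let h1 : (EuclideanSpace ℝ (Fin d)) → (EuclideanSpace ℝ (Fin d)) := fun x => x + φ x • (G x - x)
  have hh1 : ContDiff ℝ 1 h1 := contDiff_id.add (φ.contDiff.smul (hG.sub contDiff_id))
  have hout : ∀ x : (EuclideanSpace ℝ (Fin d)), 1 ≤ ‖x‖ → h1 x = x := by
    intro x hx
    have : φ x = 0 := φ.zero_of_le_dist (by simpa using hx)
    simp [h1, this]
  have hnz : ∀ x, h1 x ≠ 0 := by
    intro x
    rcases le_or_gt 1 ‖x‖ with hx | hx
    · rw [hout x hx]
      rintro rfl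
      norm_num at hx
    have hGx : ‖G x - h x‖ < min δ (1 / 4) := hGh x hx.le
    rcases le_or_gt ‖x‖ (4 / 5) with hx2 | hx2
    · have : φ x = 1 := φ.one_of_mem_closedBall (by simpa using hx2)
      have h2 : h1 x = G x := by simp [h1, this]
      rw [h2]
      intro h3
      rw [h3, zero_sub, norm_neg] at hGx
      have := hδle x hx.le
      have := lt_of_lt_of_le hGx (min_le_left _ _)
      linarith
    · intro h3
      have h4 : x = -(φ x • (G x - x)) := eq_neg_of_add_eq_zero_left h3
      have h5 : ‖x‖ ≤ ‖G x - x‖ := by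
        calc ‖x‖ = φ x * ‖G x - x‖ := by
              conv_lhs => rw [h4]
              rw [norm_neg, norm_smul, Real.norm_of_nonneg φ.nonneg]
          _ ≤ 1 * ‖G x - x‖ := by gcongr; exact φ.le_one
          _ = _ := one_mul _
      have h6 : ‖G x - x‖ ≤ ‖G x - h x‖ + ‖h x - x‖ := norm_sub_le_norm_sub_add_norm_sub _ _ _
      have := hh x hx.le
      have := lt_of_lt_of_le hGx (min_le_right _ _)
      linarith
  refine aux_noretr hd (fun x => ‖h1 x‖⁻¹ • h1 x) ?_ ?_ ?_
  · exact ((hh1.norm ℝ hnz).inv (fun x => norm_ne_zero_iff.2 (hnz x))).smul hh1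
  · intro x
    have := norm_ne_zero_iff.2 (hnz x)
    rw [norm_smul, norm_inv, norm_norm]; field_simp
  · intro x hx
    simp [hout x hx.ge, hx]

lemma aux_zero {d : ℕ} (hd : 1 ≤ d) (ρ : ℝ) (hρ : 0 < ρ)
    (h : EuclideanSpace ℝ (Fin d) → EuclideanSpace ℝ (Fin d))
    (hc : ContinuousOn h (closedBall 0 ρ))
    (hh : ∀ x, ‖x‖ ≤ ρ → ‖h x - x‖ ≤ ρ / 2) : ∃ x, ‖x‖ ≤ ρ ∧ h x = 0 := by
  have hn : ∀ x : EuclideanSpace ℝ (Fin d), ‖x‖ ≤ 1 → ‖ρ • x‖ ≤ ρ := by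
    intro x hx
    rw [norm_smul, Real.norm_of_nonneg hρ.le]
    nlinarith
  obtain ⟨x, hx, hx0⟩ := aux_zero1 hd (fun x => ρ⁻¹ • h (ρ • x)) (by
      refine ContinuousOn.fun_const_smul (hc.comp (f := fun x => ρ • x) (by fun_prop) ?_) ρ⁻¹
      intro x hx
      simpa using hn x (by simpa using hx)) (by
      intro x hx
      have h1 := hh (ρ • x) (hn x hx)
      have : ρ⁻¹ • h (ρ • x) - x = ρ⁻¹ • (h (ρ • x) - ρ • x) := by
        rw [smul_sub, smul_smul, inv_mul_cancel₀ hρ.ne', one_smul]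
      rw [this, norm_smul, norm_inv, Real.norm_of_nonneg hρ.le, inv_mul_le_iff₀ hρ]
      linarith)
  exact ⟨ρ • x, hn x hx, (smul_eq_zero.1 hx0).resolve_left (by positivity)⟩

theorem zeros_persist_of_surjective_derivative
    {A : Type*} [TopologicalSpace A] {s d : ℕ} (hd : 1 ≤ d) (hsd : d ≤ s)
    (U : Set (EuclideanSpace ℝ (Fin s))) (hU : IsOpen U)
    (hU0 : (0 : EuclideanSpace ℝ (Fin s)) ∈ U)
    (f : A → EuclideanSpace ℝ (Fin s) → EuclideanSpace ℝ (Fin d))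
    (hf : ContinuousOn (fun p : A × EuclideanSpace ℝ (Fin s) => f p.1 p.2)
      (Set.univ ×ˢ U))
    (a₀ : A) (hC1 : ContDiffOn ℝ 1 (f a₀) U) (hf0 : f a₀ 0 = 0)
    (hderiv : Function.Surjective (fderiv ℝ (f a₀) 0)) :
    ∃ r : ℝ, 0 < r ∧ Metric.closedBall (0 : EuclideanSpace ℝ (Fin s)) r ⊆ U ∧
      ∃ W ∈ nhds a₀, ∀ a ∈ W,
        ∃ m ∈ Metric.closedBall (0 : EuclideanSpace ℝ (Fin s)) r, f a m = 0 := by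
  obtain ⟨r, hr, hrU⟩ := Metric.nhds_basis_closedBall.mem_iff.1 (hU.mem_nhds hU0)
  refine ⟨r, hr, hrU, ?_⟩
  set D := fderiv ℝ (f a₀) 0 with hD
  obtain ⟨R₀, hR₀⟩ := D.toLinearMap.exists_rightInverse_of_surjective
    (LinearMap.range_eq_top.2 hderiv)
  let R := LinearMap.toContinuousLinearMap R₀
  have hDR : ∀ y, D (R y) = y := fun y => congrArg (fun T => T y) hR₀
  have hdiff : HasFDerivAt (f a₀) D 0 :=
    ((hC1.differentiableOn (by norm_num)).differentiableAt (hU.mem_nhds hU0)).hasFDerivAt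
  have hcomp : HasFDerivAt (fun y => f a₀ (R y)) (D.comp R) 0 := by
    refine HasFDerivAt.comp (g := f a₀) 0 ?_ R.hasFDerivAt
    simpa using hdiff
  have hlo := hcomp.isLittleO.def (c := 1 / 4) (by norm_num)
  obtain ⟨ρ₁, hρ₁, hρb⟩ := Metric.nhds_basis_closedBall.mem_iff.1 hlo
  let ρ := min ρ₁ (r / (‖R‖ + 1))
  have hρ : 0 < ρ := by positivity
  have hRb : ∀ y, ‖y‖ ≤ ρ → ‖R y‖ ≤ r := by
    intro y hy
    have h1 : ρ * (‖R‖ + 1) ≤ r := by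
      rw [← le_div_iff₀ (by positivity)]; exact min_le_right _ _
    have h2 := R.le_opNorm y
    nlinarith [norm_nonneg R, norm_nonneg y]
  have hRU : ∀ y, ‖y‖ ≤ ρ → R y ∈ U := fun y hy => hrU (by simpa using hRb y hy)
  have h0 : ∀ y, ‖y‖ ≤ ρ → ‖f a₀ (R y) - y‖ ≤ ρ / 4 := by
    intro y hy
    have := hρb (show y ∈ closedBall 0 ρ₁ by simpa using hy.trans (min_le_left _ _))
    simp [hf0, hDR] at this
    linarith
  have hW : ∀ᶠ a in nhds a₀, ∀ y ∈ closedBall (0 : EuclideanSpace ℝ (Fin d)) ρ,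
      ‖f a (R y) - y‖ < ρ / 2 := by
    refine (isCompact_closedBall _ _).eventually_forall_of_forall_eventually ?_
    intro y hy
    have hy : ‖y‖ ≤ ρ := by simpa using hy
    have hca : ContinuousAt (fun p : A × EuclideanSpace ℝ (Fin s) => f p.1 p.2) (a₀, R y) :=
      hf.continuousAt ((isOpen_univ.prod hU).mem_nhds ⟨trivial, hRU y hy⟩)
    have hcb : ContinuousAt (fun p : A × EuclideanSpace ℝ (Fin d) => f p.1 (R p.2)) (a₀, y) :=
      ContinuousAt.comp (f := fun p : A × EuclideanSpace ℝ (Fin d) => (p.1, R p.2))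
        (x := (a₀, y)) hca (by fun_prop)
    have hcc := (hcb.sub continuousAt_snd).norm
    refine hcc.eventually_lt_const ?_
    have := h0 y hy
    show ‖f a₀ (R y) - y‖ < ρ / 2
    linarith
  refine ⟨_, hW, ?_⟩
  intro a ha
  obtain ⟨y, hy, hy0⟩ := aux_zero hd ρ hρ (fun y => f a (R y)) (by
      refine ContinuousOn.comp (g := fun p : A × EuclideanSpace ℝ (Fin s) => f p.1 p.2)
        (f := fun y => (a, R y)) hf (by fun_prop) ?_
      intro y hy
      exact ⟨trivial, hRU y (by simpa using hy)⟩)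
    (fun y hy => (ha y (by simpa using hy)).le)
  exact ⟨R y, by simpa using hRb y hy, hy0⟩
end

section
/- Let g(x, y) = 12y² + 12xy − 3x + 3x² and h(x, y) = 24y + 12x. There exists δ > 0 such that for every (x, y) with 0 < x < δ, |y| < δ and g(x, y) = 0, one has: h(x, y) > 0 if y > 0, and h(x, y) < 0 if y < 0. (Here h is the second partial derivative ∂²f/∂y² of the underlying function f, so along the two branches of the critical-point curve the Morse index of y ↦ f(x, y) equals 0 and 1 respectively, giving a jump of the Morse index at the origin without bifurcation.) -/
/-- **Sign of the second derivative along the two branches of critical points.**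
Let `g(x, y) = 12y² + 12xy − 3x + 3x²` and `h(x, y) = 24y + 12x` (so `g = ∂f/∂y` and
`h = ∂²f/∂y²` for `f(x,y) = 4y³ + 6xy² + 3xy − 3x²y`).  There is a `δ > 0` such that for
every `(x, y)` with `0 < x < δ`, `|y| < δ` and `g(x, y) = 0`, one has `h(x, y) > 0` if
`y > 0` and `h(x, y) < 0` if `y < 0`: along the two branches of the critical-point curve
the Morse index of `y ↦ f(x, y)` equals `0` and `1` respectively, giving a jump of the
Morse index at the origin without bifurcation. -/
theorem second_derivative_sign_on_branches :
    ∃ δ : ℝ, 0 < δ ∧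
      ∀ x y : ℝ, 0 < x → x < δ → |y| < δ →
        12 * y ^ 2 + 12 * x * y - 3 * x + 3 * x ^ 2 = 0 →
        ((0 < y → 0 < 24 * y + 12 * x) ∧ (y < 0 → 24 * y + 12 * x < 0)) := by
  refine ⟨1, one_pos, fun x y hx hx1 _ hg => ⟨fun hy => by linarith, fun hy => ?_⟩⟩
  by_contra hc
  have h0 : 0 ≤ 2 * y + x := by linarith
  have h1 : 2 * y + x < x := by linarith
  have h2 : (2 * y + x) ^ 2 = x := by linarith [hg, (by ring : (2 * y + x) ^ 2 = 4 * y ^ 2 + 4 * x * y + x ^ 2)]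
  nlinarith
end
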